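/- arXiv:1104.2195 — 7 statements merged into one kernel-verified Lean document; each statement's English description precedes it below -/
import Mathlib

section
/- Let (X,G) be a G-system with G a countable discrete amenable group, let 𝓤 be a finite open cover of X, and let 𝓕 = {f_E}_{E∈𝓕(G)} be a sub-additive potential on (X,G). Then for every μ ∈ M(X,G), P(G,𝓕;𝓤) ≥ h_μ(G,𝓤) + 𝓕_*(μ). -/
open MeasureTheory Filter Topology
open scoped Pointwise symmDiff Classical ENNReal

/-- A Følner sequence for a countable discrete group `G`: a sequence of nonempty finite
subsets `F n` of `G` such that `|gF_n △ F_n| / |F_n| → 0` for every `g ∈ G`. -/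
def FolnerSeq (G : Type*) [Group G] [DecidableEq G] (F : ℕ → Finset G) : Prop :=
  (∀ n, (F n).Nonempty) ∧
    ∀ g : G, Tendsto (fun n => (((g • F n) ∆ F n).card : ℝ) / (F n).card) atTop (𝓝 0)

/-- The family of sets `𝓥` is finer than the family `𝓦`. -/
def IsFinerFam {X : Type*} (V W : Set (Set X)) : Prop := ∀ A ∈ V, ∃ B ∈ W, A ⊆ B

/-- The cover `𝓤_E = ⋁_{g ∈ E} g⁻¹ 𝓤` associated to a finite cover `𝓤` and `E ∈ 𝓕(G)`. -/
def DynRefine (G : Type*) {X : Type*} [SMul G X] (U : Finset (Set X)) (E : Finset G) :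
    Set (Set X) :=
  {V | ∃ u : G → Set X, (∀ g ∈ E, u g ∈ U) ∧ V = ⋂ g ∈ E, (fun x => g • x) ⁻¹' u g}

/-- `P_E(G,𝓕;𝓤)`: the infimum of `Σ_{V ∈ 𝓥} sup_{x ∈ V} e^{f_E(x)}` over all finite Borel
covers `𝓥` of `X` finer than `𝓤_E`. -/
noncomputable def CoverPressure (G : Type*) {X : Type*} [SMul G X] [MeasurableSpace X]
    (f : Finset G → X → ℝ) (U : Finset (Set X)) (E : Finset G) : ℝ :=
  sInf {S : ℝ | ∃ V : Finset (Set X), (∀ A ∈ V, MeasurableSet A) ∧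
    ⋃₀ (↑V : Set (Set X)) = Set.univ ∧ IsFinerFam (↑V) (DynRefine G U E) ∧
    S = ∑ A ∈ V, ⨆ x ∈ A, Real.exp (f E x)}

/-- A finite Borel partition of `X`. -/
def IsBorelPartition {X : Type*} [MeasurableSpace X] (P : Finset (Set X)) : Prop :=
  (∀ A ∈ P, MeasurableSet A) ∧ ⋃₀ (↑P : Set (Set X)) = Set.univ ∧
    (↑P : Set (Set X)).PairwiseDisjoint id

/-- `H_μ(α) = -Σ_{A ∈ α} μ(A) log μ(A)`. -/
noncomputable def PartEnt {X : Type*} [MeasurableSpace X] (μ : Measure X)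
    (P : Finset (Set X)) : ℝ :=
  ∑ A ∈ P, Real.negMulLog (μ A).toReal

/-- `H_μ(𝓒)`: the infimum of `H_μ(α)` over finite Borel partitions `α` finer than `𝓒`. -/
noncomputable def CoverEnt {X : Type*} [MeasurableSpace X] (μ : Measure X)
    (C : Set (Set X)) : ℝ :=
  sInf {h : ℝ | ∃ P : Finset (Set X), IsBorelPartition P ∧ IsFinerFam (↑P) C ∧ h = PartEnt μ P}

/-- `μ ∈ M(X,G)`: a `G`-invariant Borel probability measure. -/
def GInvariant (G : Type*) {X : Type*} [SMul G X] [MeasurableSpace X] (μ : Measure X) : Prop :=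
  IsProbabilityMeasure μ ∧ ∀ g : G, Measure.map (fun x => g • x) μ = μ

/-- `μ ∈ M^e(X,G)`: an ergodic `G`-invariant Borel probability measure. -/
def GErgodic (G : Type*) {X : Type*} [SMul G X] [MeasurableSpace X] (μ : Measure X) : Prop :=
  GInvariant G μ ∧ ∀ s : Set X, MeasurableSet s → (∀ g : G, (fun x => g • x) ⁻¹' s = s) →
    μ s = 0 ∨ μ s = 1

/-- A sub-additive potential on `(X,G)`: a family of continuous functions satisfying
(C1) subadditivity on disjoint unions, (C2) `f_{Eg}(x) = f_E(gx)`, and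
(C3) `sup (f_E - f_{E ∪ {g}}) < ∞`. -/
def SubaddPotential (G : Type*) {X : Type*} [Group G] [DecidableEq G] [SMul G X]
    [TopologicalSpace X] (f : Finset G → X → ℝ) : Prop :=
  (∀ E : Finset G, Continuous (f E)) ∧
  (∀ (E F : Finset G) (x : X), E.Nonempty → F.Nonempty → Disjoint E F →
    f (E ∪ F) x ≤ f E x + f F x) ∧
  (∀ (E : Finset G) (g : G) (x : X), f (E.image fun a => a * g) x = f E (g • x)) ∧
  (∃ C : ℝ, ∀ (E : Finset G) (g : G) (x : X), E.Nonempty → f E x - f (insert g E) x ≤ C)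

/-- The Gibbs inequality `∑ p_i (log b_i - log p_i) ≤ log ∑ b_i` for a probability vector `p`. -/
theorem sum_negMulLog_add_mul_log_le {ι : Type*} [Fintype ι] {p b : ι → ℝ}
    (hp : ∀ i, 0 ≤ p i) (hsum : ∑ i, p i = 1) (hb : ∀ i, 0 ≤ b i)
    (hpos : ∀ i, 0 < p i → 0 < b i) :
    0 < ∑ i, b i ∧
      ∑ i, (Real.negMulLog (p i) + p i * Real.log (b i)) ≤ Real.log (∑ i, b i) := by
  have hZ : 0 < ∑ i, b i := by
    obtain ⟨i, hi, h⟩ : ∃ i ∈ Finset.univ, 0 < p i := by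
      apply Finset.exists_lt_of_sum_lt (f := fun _ => (0 : ℝ))
      simp [hsum]
    exact (hpos i h).trans_le
      (Finset.single_le_sum (fun j _ => hb j) (Finset.mem_univ i))
  refine ⟨hZ, ?_⟩
  set Z := ∑ i, b i
  have key : ∀ i, Real.negMulLog (p i) + p i * Real.log (b i)
      ≤ p i * Real.log Z + (b i / Z - p i) := by
    intro i
    rcases (hp i).eq_or_lt with h | h
    · have := div_nonneg (hb i) hZ.le
      simpa [← h] using this
    · have hbi := hpos i h
      have h1 := Real.log_le_sub_one_of_pos (div_pos hbi (mul_pos h hZ))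
      rw [Real.log_div hbi.ne' (mul_pos h hZ).ne', Real.log_mul h.ne' hZ.ne'] at h1
      have h2 := mul_le_mul_of_nonneg_left h1 h.le
      have h3 : p i * (b i / (p i * Z) - 1) = b i / Z - p i := by field_simp
      rw [h3] at h2
      rw [Real.negMulLog]
      linarith
  calc _ ≤ ∑ i, (p i * Real.log Z + (b i / Z - p i)) := Finset.sum_le_sum fun i _ => key i
    _ = Real.log Z := by
      rw [Finset.sum_add_distrib, Finset.sum_sub_distrib, ← Finset.sum_mul, ← Finset.sum_div,
        hsum, div_self hZ.ne']
      ring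

theorem exp_le_iSup_mem {X : Type*} [TopologicalSpace X] [CompactSpace X] {φ : X → ℝ}
    (hφ : Continuous φ) {A : Set X} {x : X} (hx : x ∈ A) :
    Real.exp (φ x) ≤ ⨆ y ∈ A, Real.exp (φ y) := by
  obtain ⟨M, hM⟩ := (isCompact_range (Real.continuous_exp.comp hφ)).bddAbove
  have hbdd : BddAbove (Set.range fun y => ⨆ (_ : y ∈ A), Real.exp (φ y)) := by
    refine ⟨max M 0, ?_⟩
    rintro _ ⟨y, rfl⟩
    exact Real.iSup_le (fun _ => (hM ⟨y, rfl⟩).trans (le_max_left _ _)) (le_max_right _ _)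
  simpa [hx] using le_ciSup hbdd x

theorem partEnt_nonneg {X : Type*} [MeasurableSpace X] (μ : Measure X) [IsProbabilityMeasure μ]
    (P : Finset (Set X)) : 0 ≤ PartEnt μ P :=
  Finset.sum_nonneg fun _ _ => Real.negMulLog_nonneg ENNReal.toReal_nonneg measureReal_le_one

theorem coverEnt_le_partEnt {X : Type*} [MeasurableSpace X] (μ : Measure X)
    [IsProbabilityMeasure μ] {C : Set (Set X)} {P : Finset (Set X)}
    (hP : IsBorelPartition P) (hPC : IsFinerFam (↑P) C) : CoverEnt μ C ≤ PartEnt μ P := by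
  refine csInf_le ⟨0, ?_⟩ ⟨P, hP, hPC, rfl⟩
  rintro _ ⟨Q, -, -, rfl⟩
  exact partEnt_nonneg μ Q

/-- The entropy of a cover plus the integral of a continuous function `φ` is bounded by the
logarithm of the partition sum of `φ` over any finite Borel cover finer than the given one. -/
theorem coverEnt_add_integral_le_log_sum {X : Type*} [TopologicalSpace X] [CompactSpace X]
    [MeasurableSpace X] [BorelSpace X] (μ : Measure X) [IsProbabilityMeasure μ] {φ : X → ℝ}
    (hφ : Continuous φ) {C : Set (Set X)} {V : Finset (Set X)}
    (hVm : ∀ A ∈ V, MeasurableSet A) (hVc : ⋃₀ (↑V : Set (Set X)) = Set.univ)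
    (hVC : IsFinerFam (↑V) C) :
    0 < ∑ A ∈ V, (⨆ x ∈ A, Real.exp (φ x)) ∧
      CoverEnt μ C + ∫ x, φ x ∂μ ≤ Real.log (∑ A ∈ V, ⨆ x ∈ A, Real.exp (φ x)) := by
  obtain ⟨D, hDle, hDsup, hDdisj, hDm⟩ : ∃ D : V → Set X, (∀ i, D i ⊆ i.1) ∧
      ⋃ i, D i = Set.univ ∧ Pairwise (Function.onFun Disjoint D) ∧
      ∀ i, MeasurableSet (D i) := by
    let e := V.equivFin
    let g : Fin V.card → Set X := fun j => (e.symm j).1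
    refine ⟨fun i => disjointed g (e i), fun i => ?_, ?_, ?_, fun i => ?_⟩
    · simpa [g] using disjointed_subset g (e i)
    · rw [e.surjective.iUnion_comp (disjointed g), iUnion_disjointed,
        e.symm.surjective.iUnion_comp (fun A : V => A.1), ← hVc, Set.sUnion_eq_iUnion]
      rfl
    · exact (disjoint_disjointed g).comp_of_injective e.injective
    · exact disjointedRec (p := MeasurableSet) (fun _ j ht => ht.diff (hVm _ (e.symm j).2))
        (hVm _ (e.symm (e i)).2)
  have hPart : IsBorelPartition (Finset.univ.image D) := by
    refine ⟨Finset.forall_mem_image.2 fun i _ => hDm i, by simpa [Set.sUnion_range] using hDsup, ?_⟩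
    simp only [Finset.coe_image, Finset.coe_univ, Set.image_univ]
    rintro _ ⟨i, rfl⟩ _ ⟨j, rfl⟩ hij
    exact hDdisj fun h => hij (by rw [h])
  have hFine : IsFinerFam (↑(Finset.univ.image D)) C := by
    intro A hA
    obtain ⟨i, -, rfl⟩ := Finset.mem_image.1 hA
    obtain ⟨B, hB, hiB⟩ := hVC i.1 i.2
    exact ⟨B, hB, (hDle i).trans hiB⟩
  have hEnt : PartEnt μ (Finset.univ.image D) = ∑ i, Real.negMulLog (μ.real (D i)) :=
    Finset.sum_image_of_disjoint (g := fun A : Set X => Real.negMulLog (μ.real A)) (by simp)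
      (hDdisj.set_pairwise _)
  set b : V → ℝ := fun i => ⨆ x ∈ i.1, Real.exp (φ x) with hb_def
  have hb : ∀ i, 0 ≤ b i := fun i =>
    Real.iSup_nonneg fun x => Real.iSup_nonneg fun _ => (Real.exp_pos _).le
  have hexp : ∀ i, ∀ x ∈ D i, Real.exp (φ x) ≤ b i := fun i x hx =>
    exp_le_iSup_mem hφ (hDle i hx)
  have hsum : ∑ i, μ.real (D i) = 1 := by
    rw [← measureReal_iUnion_fintype hDdisj hDm, hDsup, probReal_univ]
  have hpos : ∀ i, 0 < μ.real (D i) → 0 < b i := by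
    intro i hi
    obtain ⟨x, hx⟩ : (D i).Nonempty := by
      rw [Set.nonempty_iff_ne_empty]
      intro h
      simp [h] at hi
    exact (Real.exp_pos _).trans_le (hexp i x hx)
  obtain ⟨hZ, hJ⟩ := sum_negMulLog_add_mul_log_le (fun i => measureReal_nonneg) hsum hb hpos
  have hbV : ∑ i, b i = ∑ A ∈ V, ⨆ x ∈ A, Real.exp (φ x) :=
    Finset.sum_coe_sort V fun A => ⨆ x ∈ A, Real.exp (φ x)
  rw [hbV] at hZ hJ
  refine ⟨hZ, le_trans ?_ hJ⟩
  have hint : Integrable φ μ :=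
    hφ.integrable_of_hasCompactSupport (HasCompactSupport.of_compactSpace φ)
  have hI : ∫ x, φ x ∂μ ≤ ∑ i, μ.real (D i) * Real.log (b i) := by
    rw [← setIntegral_univ, ← hDsup,
      integral_iUnion_fintype hDm hDdisj fun i => hint.integrableOn]
    refine Finset.sum_le_sum fun i _ => ?_
    calc ∫ x in D i, φ x ∂μ ≤ ∫ _ in D i, Real.log (b i) ∂μ :=
          setIntegral_mono_on hint.integrableOn (integrable_const _).integrableOn (hDm i)
            fun x hx => (Real.le_log_iff_exp_le
              ((Real.exp_pos _).trans_le (hexp i x hx))).2 (hexp i x hx)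
      _ = μ.real (D i) * Real.log (b i) := by simp
  rw [Finset.sum_add_distrib, ← hEnt]
  exact add_le_add (coverEnt_le_partEnt μ hPart hFine) hI

theorem finite_dynRefine (G : Type*) {X : Type*} [SMul G X] (U : Finset (Set X))
    (E : Finset G) : (DynRefine G U E).Finite := by
  refine (Set.finite_range fun v : E → U => ⋂ g : E, (fun x => g.1 • x) ⁻¹' (v g).1).subset ?_
  rintro _ ⟨u, hu, rfl⟩
  refine ⟨fun g => ⟨u g.1, hu g.1 g.2⟩, ?_⟩
  ext x
  simp

theorem sUnion_dynRefine (G : Type*) {X : Type*} [SMul G X] {U : Finset (Set X)}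
    (hU : ⋃₀ (↑U : Set (Set X)) = Set.univ) (E : Finset G) :
    ⋃₀ DynRefine G U E = Set.univ := by
  refine Set.eq_univ_of_forall fun x => ?_
  have h : ∀ g : G, ∃ A ∈ U, g • x ∈ A := fun g => by
    have : g • x ∈ ⋃₀ (↑U : Set (Set X)) := hU ▸ Set.mem_univ _
    simpa using this
  choose u hu hxu using h
  exact ⟨_, ⟨u, fun g _ => hu g, rfl⟩, by simpa using fun g _ => hxu g⟩

theorem isOpen_of_mem_dynRefine {G X : Type*} [SMul G X] [TopologicalSpace X]
    (hact : ∀ g : G, Continuous fun x : X => g • x) {U : Finset (Set X)}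
    (hU : ∀ A ∈ U, IsOpen A) {E : Finset G} {A : Set X} (hA : A ∈ DynRefine G U E) :
    IsOpen A := by
  obtain ⟨u, hu, rfl⟩ := hA
  exact isOpen_biInter_finset fun g hg => (hU _ (hu g hg)).preimage (hact g)

/-- The finite-window inequality `H_μ(𝓤_E) + ∫ f_E dμ ≤ log P_E(G,𝓕;𝓤)`. -/
theorem coverEnt_add_integral_le_log_coverPressure {G X : Type*} [SMul G X]
    [TopologicalSpace X] [CompactSpace X] [MeasurableSpace X] [BorelSpace X]
    (hact : ∀ g : G, Continuous fun x : X => g • x) {f : Finset G → X → ℝ}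
    {U : Finset (Set X)} (hUopen : ∀ A ∈ U, IsOpen A)
    (hUcover : ⋃₀ (↑U : Set (Set X)) = Set.univ) (μ : Measure X) [IsProbabilityMeasure μ]
    {E : Finset G} (hf : Continuous (f E)) :
    CoverEnt μ (DynRefine G U E) + ∫ x, f E x ∂μ ≤ Real.log (CoverPressure G f U E) := by
  have hle : Real.exp (CoverEnt μ (DynRefine G U E) + ∫ x, f E x ∂μ)
      ≤ CoverPressure G f U E := by
    refine le_csInf ⟨_, (finite_dynRefine G U E).toFinset, ?_, ?_, ?_, rfl⟩ ?_
    · intro A hA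
      exact (isOpen_of_mem_dynRefine hact hUopen (by simpa using hA)).measurableSet
    · simpa using sUnion_dynRefine G hUcover E
    · intro A hA
      exact ⟨A, by simpa using hA, subset_rfl⟩
    · rintro _ ⟨V, hVm, hVc, hVf, rfl⟩
      obtain ⟨hpos, h⟩ := coverEnt_add_integral_le_log_sum μ hf hVm hVc hVf
      exact (Real.le_log_iff_exp_le hpos).1 h
  exact (Real.le_log_iff_exp_le ((Real.exp_pos _).trans_le hle)).2 hle

/-- **The easy direction of the variational principle** (Step 1 of the proof of Theorem 1.1).
For a `G`-system `(X,G)` with `G` countable discrete amenable, a finite open cover `𝓤` and a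
sub-additive potential `𝓕 = {f_E}`, for every `μ ∈ M(X,G)` one has
`P(G,𝓕;𝓤) ≥ h_μ(G,𝓤) + 𝓕_*(μ)`. -/
theorem pressure_ge_entropy_add_lyapunov
    {G X : Type*} [Group G] [Countable G] [DecidableEq G]
    [MetricSpace X] [CompactSpace X] [MeasurableSpace X] [BorelSpace X]
    [MulAction G X] (hact : ∀ g : G, Continuous fun x : X => g • x)
    (f : Finset G → X → ℝ) (hf : SubaddPotential G f)
    (U : Finset (Set X)) (hUopen : ∀ A ∈ U, IsOpen A)
    (hUcover : ⋃₀ (↑U : Set (Set X)) = Set.univ)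
    (F : ℕ → Finset G) (hF : FolnerSeq G F)
    (P : ℝ)
    (hP : Tendsto (fun n => Real.log (CoverPressure G f U (F n)) / (F n).card) atTop (𝓝 P))
    (μ : Measure X) (hμ : GInvariant G μ)
    (entμ lyapμ : ℝ)
    (hhent : Tendsto (fun n => CoverEnt μ (DynRefine G U (F n)) / (F n).card) atTop (𝓝 entμ))
    (hlyap : Tendsto (fun n => (∫ x, f (F n) x ∂μ) / (F n).card) atTop (𝓝 lyapμ)) :
    entμ + lyapμ ≤ P := by
  have := hμ.1
  refine le_of_tendsto_of_tendsto' (hhent.add hlyap) hP fun n => ?_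
  rw [← add_div]
  exact div_le_div_of_nonneg_right
    (coverEnt_add_integral_le_log_coverPressure hact hUopen hUcover μ (hf.1 (F n)))
    (Nat.cast_nonneg _)
end

section
/- (Ornstein–Weiss) Let G be a countable discrete amenable group and let f : 𝓕(G) → ℝ be monotone (f(E) ≤ f(F) whenever E ⊆ F), non-negative, G-invariant (f(Fg) = f(F) for all F∈𝓕(G), g∈G), and sub-additive (f(E∪F) ≤ f(E)+f(F) for all E,F∈𝓕(G)). Then there exists a real number λ ≥ 0, depending only on G and f, such that f(F_n)/|F_n| → λ for every Følner sequence (F_n) of G. -/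
open MeasureTheory Filter Topology
open scoped Pointwise symmDiff Classical ENNReal

/-- A set all of whose left translates by elements of `K` move a proportion at most `δ`. -/
def IsInvariantUnder {G : Type*} [Group G] [DecidableEq G] (K : Finset G) (δ : ℝ)
    (F : Finset G) : Prop :=
  F.Nonempty ∧ ∀ g ∈ K, ((g • F \ F).card : ℝ) ≤ δ * F.card

/-- The filter on `Finset G` along which nonempty finite sets become left-invariant. -/
def folnerFilter (G : Type*) [Group G] [DecidableEq G] : Filter (Finset G) where
  sets := {S | ∃ (K : Finset G) (δ : ℝ), 0 < δ ∧ ∀ F, IsInvariantUnder K δ F → F ∈ S}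
  univ_sets := ⟨∅, 1, one_pos, fun _ _ => Set.mem_univ _⟩
  sets_of_superset := by
    rintro S S' ⟨K, δ, hδ, h⟩ hS
    exact ⟨K, δ, hδ, fun F hF => hS (h F hF)⟩
  inter_sets := by
    rintro S S' ⟨K, δ, hδ, h⟩ ⟨K', δ', hδ', h'⟩
    refine ⟨K ∪ K', min δ δ', lt_min hδ hδ', fun F hF => ⟨h F ⟨hF.1, fun g hg => ?_⟩,
      h' F ⟨hF.1, fun g hg => ?_⟩⟩⟩
    · exact (hF.2 g (Finset.mem_union_left _ hg)).trans (by gcongr; exact min_le_left _ _)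
    · exact (hF.2 g (Finset.mem_union_right _ hg)).trans (by gcongr; exact min_le_right _ _)

section FolnerFilter

variable {G : Type*} [Group G] [DecidableEq G]

lemma eventually_folnerFilter_iff {P : Finset G → Prop} :
    (∀ᶠ F in folnerFilter G, P F) ↔
      ∃ (K : Finset G) (δ : ℝ), 0 < δ ∧ ∀ F, IsInvariantUnder K δ F → P F :=
  Iff.rfl

lemma eventually_isInvariantUnder (K : Finset G) {δ : ℝ} (hδ : 0 < δ) :
    ∀ᶠ F in folnerFilter G, IsInvariantUnder K δ F :=
  eventually_folnerFilter_iff.2 ⟨K, δ, hδ, fun _ h => h⟩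

lemma FolnerSeq.tendsto_folnerFilter {F : ℕ → Finset G} (hF : FolnerSeq G F) :
    Tendsto F atTop (folnerFilter G) := by
  rintro S ⟨K, δ, hδ, h⟩
  have hev : ∀ᶠ n in atTop, ∀ g ∈ K, (((g • F n) ∆ F n).card : ℝ) / (F n).card < δ :=
    (Finset.eventually_all K).2 fun g _ => (hF.2 g).eventually_lt_const hδ
  refine hev.mono fun n hn => h _ ⟨hF.1 n, fun g hg => ?_⟩
  have hpos : (0 : ℝ) < (F n).card := by exact_mod_cast (hF.1 n).card_pos
  have hle : ((g • F n \ F n).card : ℝ) ≤ ((g • F n) ∆ F n).card := by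
    exact_mod_cast Finset.card_le_card Finset.subset_union_left
  exact hle.trans ((div_lt_iff₀ hpos).1 (hn g hg)).le

/-- The proportion of right translates `T * c`, `c ∈ F`, contained in an invariant set `F`. -/
lemma IsInvariantUnder.card_filter_ge {T F : Finset G} {δ : ℝ} (h : IsInvariantUnder T δ F) :
    (1 - δ * T.card) * F.card ≤ ((F.filter fun c => ∀ t ∈ T, t * c ∈ F).card : ℝ) := by
  have hsub : F ⊆ (F.filter fun c => ∀ t ∈ T, t * c ∈ F) ∪
      T.biUnion fun t => F.filter fun c => t * c ∉ F := by
    intro c hc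
    by_cases hT : ∀ t ∈ T, t * c ∈ F
    · exact Finset.mem_union_left _ (Finset.mem_filter.2 ⟨hc, hT⟩)
    · push Not at hT
      obtain ⟨t, ht, htc⟩ := hT
      exact Finset.mem_union_right _ (Finset.mem_biUnion.2 ⟨t, ht, by simp [hc, htc]⟩)
  have hbound : ∀ t ∈ T, ((F.filter fun c => t * c ∉ F).card : ℝ) ≤ δ * F.card := by
    intro t ht
    refine le_trans ?_ (h.2 t ht)
    have : (F.filter fun c => t * c ∉ F).card ≤ (t • F \ F).card := by
      refine Finset.card_le_card_of_injOn (fun c => t * c) (fun c hc => ?_)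
        (mul_right_injective t).injOn
      simp only [Finset.coe_filter, Set.mem_ofPred_eq] at hc
      simp only [Finset.coe_sdiff, Set.mem_sdiff, Finset.mem_coe]
      exact ⟨Finset.smul_mem_smul_finset hc.1, hc.2⟩
    exact_mod_cast this
  have h1 : (F.card : ℝ) ≤ (F.filter fun c => ∀ t ∈ T, t * c ∈ F).card +
      ∑ t ∈ T, ((F.filter fun c => t * c ∉ F).card : ℝ) := by
    exact_mod_cast (Finset.card_le_card hsub).trans
      ((Finset.card_union_le _ _).trans (Nat.add_le_add_left Finset.card_biUnion_le _))
  have h2 := Finset.sum_le_sum hbound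
  rw [Finset.sum_const, nsmul_eq_mul] at h2
  linarith

lemma IsInvariantUnder.exists_mul_mem {T F : Finset G} {δ : ℝ} (h : IsInvariantUnder T δ F)
    (hδ : δ * T.card < 1) : ∃ c ∈ F, ∀ t ∈ T, t * c ∈ F := by
  have hpos : (0 : ℝ) < F.card := by exact_mod_cast h.1.card_pos
  have h1 : (0 : ℝ) < ((F.filter fun c => ∀ t ∈ T, t * c ∈ F).card : ℝ) :=
    (mul_pos (sub_pos.2 hδ) hpos).trans_le h.card_filter_ge
  obtain ⟨c, hc⟩ := Finset.card_pos.1 (Nat.cast_pos.1 h1)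
  exact ⟨c, Finset.mem_filter.1 hc⟩

lemma exists_pos_mul_natCast_le_half (n : ℕ) : ∃ δ : ℝ, 0 < δ ∧ δ * n ≤ 1 / 2 := by
  refine ⟨1 / (2 * (n + 1)), by positivity, ?_⟩
  rw [div_mul_eq_mul_div, div_le_div_iff₀ (by positivity) (by positivity)]
  linarith

lemma eventually_card_ge_folnerFilter [Infinite G] (N : ℕ) :
    ∀ᶠ F in folnerFilter G, N ≤ F.card := by
  obtain ⟨T, hT⟩ := Infinite.exists_subset_card_eq G N
  obtain ⟨δ, hδ, hlt⟩ := exists_pos_mul_natCast_le_half T.card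
  filter_upwards [eventually_isInvariantUnder T hδ] with F hF
  obtain ⟨c, -, hc⟩ := hF.exists_mul_mem (hlt.trans_lt (by norm_num))
  rw [← hT]
  exact Finset.card_le_card_of_injOn (fun t => t * c) hc (mul_left_injective c).injOn

lemma eventually_eq_univ_folnerFilter [Fintype G] :
    ∀ᶠ F in folnerFilter G, F = Finset.univ := by
  obtain ⟨δ, hδ, hlt⟩ := exists_pos_mul_natCast_le_half (Finset.univ : Finset G).card
  filter_upwards [eventually_isInvariantUnder Finset.univ hδ] with F hF
  obtain ⟨c, -, hc⟩ := hF.exists_mul_mem (hlt.trans_lt (by norm_num))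
  refine Finset.eq_univ_iff_forall.2 fun x => ?_
  simpa using hc (x * c⁻¹) (Finset.mem_univ _)

/-- Double counting: the translates `T * c`, `c ∈ S`, meet `A` in at most `|T| |A| / |S|` elements
on average. -/
lemma exists_card_inter_mul_le {S : Finset G} (hS : S.Nonempty) (T A : Finset G) :
    ∃ c ∈ S, S.card * ((T * {c}) ∩ A).card ≤ T.card * A.card := by
  have hsum : ∑ c ∈ S, ((T * {c}) ∩ A).card ≤ T.card * A.card := by
    calc ∑ c ∈ S, ((T * {c}) ∩ A).card
        ≤ ∑ c ∈ S, (T.filter fun t => t * c ∈ A).card := by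
          refine Finset.sum_le_sum fun c _ => ?_
          have hsub : (T * {c}) ∩ A ⊆ (T.filter fun t => t * c ∈ A).image (· * c) := by
            intro x hx
            obtain ⟨hxT, hA⟩ := Finset.mem_inter.1 hx
            obtain ⟨t, ht, _, hc, rfl⟩ := Finset.mem_mul.1 hxT
            obtain rfl := Finset.mem_singleton.1 hc
            exact Finset.mem_image_of_mem _ (Finset.mem_filter.2 ⟨ht, hA⟩)
          exact (Finset.card_le_card hsub).trans Finset.card_image_le
      _ = ∑ t ∈ T, (S.filter fun c => t * c ∈ A).card := by
          simp only [Finset.card_filter]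
          exact Finset.sum_comm
      _ ≤ ∑ t ∈ T, A.card := by
          refine Finset.sum_le_sum fun t _ => ?_
          exact Finset.card_le_card_of_injOn (fun c => t * c)
            (fun c hc => (Finset.mem_filter.1 hc).2) (mul_right_injective t).injOn
      _ = T.card * A.card := by simp
  by_contra! hcon
  have h1 := Finset.sum_lt_sum_of_nonempty hS hcon
  rw [Finset.sum_const, ← Finset.mul_sum, smul_eq_mul] at h1
  exact absurd hsum (not_le.2 (Nat.lt_of_mul_lt_mul_left h1))

/-- As long as only a proportion `ε` of `F` is filled, translates of `T` with centres in a large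
set `S` can be chosen almost disjoint. -/
lemma exists_almost_disjoint_translates {S T : Finset G} (hS : S.Nonempty) {ε M : ℝ}
    (hSM : M ≤ 2 * S.card) (hM : 0 < M) (n : ℕ) (hn : (n * T.card : ℝ) ≤ ε * M) :
    ∃ C ⊆ S, C.card ≤ n ∧ (1 - 2 * ε) * (n * T.card) ≤ ((T * C).card : ℝ) := by
  induction n with
  | zero => exact ⟨∅, by simp⟩
  | succ n ih =>
    push_cast at hn
    have hT0 : (0 : ℝ) ≤ T.card := Nat.cast_nonneg _
    have hn' : (n * T.card : ℝ) ≤ ε * M := by linarith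
    obtain ⟨C, hCS, hCn, hC⟩ := ih hn'
    obtain ⟨c, hcS, hc⟩ := exists_card_inter_mul_le hS T (T * C)
    refine ⟨insert c C, Finset.insert_subset hcS hCS, (Finset.card_insert_le _ _).trans (by lia),
      ?_⟩
    have hcard : (T * insert c C).card + ((T * {c}) ∩ (T * C)).card = T.card + (T * C).card := by
      rw [Finset.insert_eq, Finset.mul_union, Finset.card_union_add_card_inter,
        Finset.card_mul_singleton]
    have hTC : ((T * C).card : ℝ) ≤ ε * M := by
      have h1 : ((T * C).card : ℝ) ≤ T.card * C.card := by exact_mod_cast Finset.card_mul_le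
      have h2 : (C.card : ℝ) ≤ n := by exact_mod_cast hCn
      nlinarith
    have hinter : (((T * {c}) ∩ (T * C)).card : ℝ) ≤ 2 * ε * T.card := by
      have h1 : (S.card * ((T * {c}) ∩ (T * C)).card : ℝ) ≤ T.card * (T * C).card := by
        exact_mod_cast hc
      have h2 : M / 2 * ((T * {c}) ∩ (T * C)).card ≤ M / 2 * (2 * ε * T.card) := by
        calc M / 2 * (((T * {c}) ∩ (T * C)).card : ℝ)
            ≤ S.card * ((T * {c}) ∩ (T * C)).card := by gcongr; linarith
          _ ≤ T.card * (T * C).card := h1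
          _ ≤ T.card * (ε * M) := by gcongr
          _ = M / 2 * (2 * ε * T.card) := by ring
      exact le_of_mul_le_mul_left h2 (by positivity)
    have hcard' : ((T * insert c C).card : ℝ) + ((T * {c}) ∩ (T * C)).card =
        T.card + (T * C).card := by exact_mod_cast hcard
    push_cast
    linarith

lemma card_smul_mul_sdiff_le (g : G) (T C : Finset G) :
    (g • (T * C) \ (T * C)).card ≤ C.card * (g • T \ T).card := by
  have hsub : g • (T * C) \ (T * C) ⊆ (g • T \ T) * C := by
    intro x hx
    rw [Finset.mem_sdiff, ← smul_mul_assoc, Finset.mem_mul] at hx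
    obtain ⟨⟨t, ht, c, hc, rfl⟩, hx⟩ := hx
    exact Finset.mul_mem_mul
      (Finset.mem_sdiff.2 ⟨ht, fun htT => hx (Finset.mul_mem_mul htT hc)⟩) hc
  exact (Finset.card_le_card hsub).trans (Finset.card_mul_le.trans_eq (mul_comm _ _))

lemma card_smul_sdiff_sdiff_le (g : G) (F A : Finset G) :
    (g • (F \ A) \ (F \ A)).card ≤ (g • F \ F).card + (g • A \ A).card := by
  have hsub : g • (F \ A) \ (F \ A) ⊆ (g • F \ F) ∪ (A \ g • A) := by
    intro x hx
    rw [Finset.smul_finset_sdiff] at hx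
    simp only [Finset.mem_sdiff, Finset.mem_union] at hx ⊢
    tauto
  have hcard : (A \ g • A).card = (g • A \ A).card :=
    Finset.card_sdiff_comm (Finset.card_smul_finset g A).symm
  exact (Finset.card_le_card hsub).trans ((Finset.card_union_le _ _).trans_eq (by rw [hcard]))

variable {f : Finset G → ℝ}

lemma subadditive_mul_le
    (hinv : ∀ (E : Finset G) (g : G), E.Nonempty → f (E.image fun a => a * g) = f E)
    (hsub : ∀ E F : Finset G, E.Nonempty → F.Nonempty → f (E ∪ F) ≤ f E + f F)
    {T C : Finset G} (hT : T.Nonempty) (hC : C.Nonempty) : f (T * C) ≤ C.card * f T := by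
  have hsing : ∀ c, f (T * {c}) = f T := fun c => by
    rw [Finset.mul_singleton]
    exact hinv T c hT
  induction hC using Finset.Nonempty.cons_induction with
  | singleton c => simp [hsing]
  | cons c C hc hC ih =>
    rw [Finset.cons_eq_insert, Finset.card_insert_of_notMem hc, Finset.insert_eq,
      Finset.mul_union]
    refine (hsub _ _ (hT.mul (Finset.singleton_nonempty c)) (hT.mul hC)).trans ?_
    rw [hsing]
    push_cast
    linarith

lemma subadditive_le_card_mul
    (hinv : ∀ (E : Finset G) (g : G), E.Nonempty → f (E.image fun a => a * g) = f E)
    (hsub : ∀ E F : Finset G, E.Nonempty → F.Nonempty → f (E ∪ F) ≤ f E + f F)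
    {E : Finset G} (hE : E.Nonempty) : f E ≤ E.card * f {1} := by
  have h := subadditive_mul_le hinv hsub (Finset.singleton_nonempty (1 : G)) hE
  rwa [Finset.singleton_one, one_mul] at h

/-- Filling a small proportion `ε` of a set `F` of near-maximal density with translates of a set
`T` of near-minimal density compares the two extremal densities `u` and `l`. -/
lemma density_comparison [Infinite G]
    (hinv : ∀ (E : Finset G) (g : G), E.Nonempty → f (E.image fun a => a * g) = f E)
    (hsub : ∀ E F : Finset G, E.Nonempty → F.Nonempty → f (E ∪ F) ≤ f E + f F)
    (hnonneg : ∀ E : Finset G, E.Nonempty → 0 ≤ f E)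
    {u l ε : ℝ} (hu : 0 ≤ u) (hε : 0 < ε) (hε' : ε ≤ 1 / 4)
    (hle : ∀ η > 0, ∀ᶠ F in folnerFilter G, f F / F.card < u + η)
    (hge : ∀ η > 0, ∃ᶠ F in folnerFilter G, u - η < f F / F.card)
    (hlow : ∀ η > 0, ∃ᶠ F in folnerFilter G, f F / F.card < l + η) :
    u * (1 - 2 * ε) ≤ l + 5 * ε := by
  obtain ⟨K, δ, hδ, hK⟩ := eventually_folnerFilter_iff.1 (hle (ε ^ 2) (by positivity))
  obtain ⟨T, hTl, hT⟩ := ((hlow ε hε).and_eventually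
    (eventually_isInvariantUnder K (show 0 < δ / 4 by positivity))).exists
  have hTpos : (0 : ℝ) < T.card := by exact_mod_cast hT.1.card_pos
  rw [div_lt_iff₀ hTpos] at hTl
  obtain ⟨δ', hδ', hδT⟩ := exists_pos_mul_natCast_le_half T.card
  obtain ⟨N, hN⟩ := exists_nat_ge (2 * T.card / ε)
  obtain ⟨F, hFu, ⟨hFK, hFT⟩, hFN⟩ := ((hge (ε ^ 2) (by positivity)).and_eventually
    (((eventually_isInvariantUnder K (show 0 < δ / 4 by positivity)).and
      (eventually_isInvariantUnder T hδ')).and (eventually_card_ge_folnerFilter N))).exists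
  have hFpos : (0 : ℝ) < F.card := by exact_mod_cast hFK.1.card_pos
  rw [lt_div_iff₀ hFpos] at hFu
  have hFT' : 2 * (T.card : ℝ) ≤ ε * F.card := by
    have h1 : 2 * T.card / ε ≤ (F.card : ℝ) := hN.trans (by exact_mod_cast hFN)
    rw [div_le_iff₀ hε] at h1
    linarith
  set S := F.filter fun c => ∀ t ∈ T, t * c ∈ F with hSdef
  have hScard : (F.card : ℝ) ≤ 2 * S.card := by
    have := hFT.card_filter_ge
    nlinarith
  have hS : S.Nonempty := Finset.card_pos.1 (Nat.cast_pos.1 (by linarith : (0 : ℝ) < S.card))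
  set n := ⌊ε * F.card / T.card⌋₊ with hndef
  have hn : (n * T.card : ℝ) ≤ ε * F.card :=
    (le_div_iff₀ hTpos).1 (Nat.floor_le (by positivity))
  have hn' : ε * F.card ≤ 2 * (n * T.card : ℝ) := by
    have h1 := Nat.lt_floor_add_one (ε * F.card / T.card)
    rw [← hndef, div_lt_iff₀ hTpos] at h1
    linarith
  have hnpos : (0 : ℝ) < n * T.card := by
    have : 0 < ε * F.card := by positivity
    linarith
  obtain ⟨C, hCS, hCn, hCcard⟩ := exists_almost_disjoint_translates hS hScard hFpos n hn
  have hCn' : (C.card : ℝ) ≤ n := by exact_mod_cast hCn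
  set A := T * C with hAdef
  have hApos : (0 : ℝ) < A.card := lt_of_lt_of_le (mul_pos (by linarith) hnpos) hCcard
  have hA : A.Nonempty := Finset.card_pos.1 (Nat.cast_pos.1 hApos)
  have hC : C.Nonempty := (Finset.mul_nonempty.1 hA).2
  have hAF : A ⊆ F := by
    refine Finset.mul_subset_iff.2 fun t ht c hc => ?_
    exact (Finset.mem_filter.1 (hCS hc)).2 t ht
  have hAle : (A.card : ℝ) ≤ ε * F.card := by
    have h1 : (A.card : ℝ) ≤ T.card * C.card := by exact_mod_cast Finset.card_mul_le
    nlinarith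
  have hBcard : ((F \ A).card : ℝ) = F.card - A.card := by
    rw [Finset.card_sdiff_of_subset hAF, Nat.cast_sub (Finset.card_le_card hAF)]
  have hBge : (F.card : ℝ) ≤ 2 * (F \ A).card := by
    rw [hBcard]
    nlinarith
  have hBpos : (0 : ℝ) < (F \ A).card := by linarith
  have hB : IsInvariantUnder K δ (F \ A) := by
    refine ⟨Finset.card_pos.1 (Nat.cast_pos.1 hBpos), fun g hg => ?_⟩
    have h1 : ((g • (F \ A) \ (F \ A)).card : ℝ) ≤ (g • F \ F).card + (g • A \ A).card := by
      exact_mod_cast card_smul_sdiff_sdiff_le g F A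
    have h2 : ((g • A \ A).card : ℝ) ≤ C.card * (g • T \ T).card := by
      exact_mod_cast card_smul_mul_sdiff_le g T C
    have h3 := hFK.2 g hg
    have h4 : (C.card * (g • T \ T).card : ℝ) ≤ δ / 4 * F.card := by
      calc (C.card * (g • T \ T).card : ℝ) ≤ n * (δ / 4 * T.card) :=
            mul_le_mul hCn' (hT.2 g hg) (Nat.cast_nonneg _) (Nat.cast_nonneg _)
        _ = δ / 4 * (n * T.card) := by ring
        _ ≤ δ / 4 * (ε * F.card) := by gcongr
        _ ≤ δ / 4 * (1 * F.card) := by gcongr; linarith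
        _ = δ / 4 * F.card := by ring
    nlinarith
  have hfB := hK _ hB
  rw [div_lt_iff₀ hBpos, hBcard] at hfB
  have hfA : f A ≤ n * ((l + ε) * T.card) := by
    calc f A ≤ C.card * f T := subadditive_mul_le hinv hsub hT.1 hC
      _ ≤ n * ((l + ε) * T.card) :=
        mul_le_mul hCn' hTl.le (hnonneg T hT.1) (Nat.cast_nonneg _)
  have hfF : f F ≤ f A + f (F \ A) := by
    simpa [Finset.union_sdiff_of_subset hAF] using hsub A (F \ A) hA hB.1
  have hfinal : u * (1 - 2 * ε) * (n * T.card) ≤ (l + 5 * ε) * (n * T.card) := by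
    have h1 : u * ((1 - 2 * ε) * (n * T.card)) ≤ u * A.card := by gcongr
    have h2 : ε ^ 2 * F.card ≤ ε * (2 * (n * T.card)) := by
      rw [pow_two, mul_assoc]
      gcongr
    have h3 : 0 ≤ ε ^ 2 * (A.card : ℝ) := by positivity
    linarith
  exact le_of_mul_le_mul_right hfinal hnpos

end FolnerFilter

/-- **Ornstein–Weiss lemma** (Lemma 2.1). Let `G` be a countable amenable group and
`f : 𝓕(G) → ℝ` a monotone, non-negative, `G`-invariant, sub-additive function on the finite
non-empty subsets of `G`. Then there is `λ ≥ 0`, depending only on `G` and `f`, with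
`f(F_n)/|F_n| → λ` for every Følner sequence `(F_n)` of `G`. -/
theorem ornstein_weiss {G : Type*} [Group G] [Countable G] [DecidableEq G]
    (hamen : ∃ F : ℕ → Finset G, FolnerSeq G F)
    (f : Finset G → ℝ)
    (hmono : ∀ E F : Finset G, E.Nonempty → E ⊆ F → f E ≤ f F)
    (hnonneg : ∀ E : Finset G, E.Nonempty → 0 ≤ f E)
    (hinv : ∀ (E : Finset G) (g : G), E.Nonempty → f (E.image fun a => a * g) = f E)
    (hsub : ∀ E F : Finset G, E.Nonempty → F.Nonempty → f (E ∪ F) ≤ f E + f F) :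
    ∃ lam : ℝ, 0 ≤ lam ∧ ∀ F : ℕ → Finset G, FolnerSeq G F →
      Tendsto (fun n => f (F n) / (F n).card) atTop (𝓝 lam) := by
  let φ : Finset G → ℝ := fun F => f F / F.card
  have hneBot : (folnerFilter G).NeBot := by
    obtain ⟨F, hF⟩ := hamen
    exact hF.tendsto_folnerFilter.neBot
  have hne : ∀ᶠ F in folnerFilter G, F.Nonempty :=
    (eventually_isInvariantUnder ∅ one_pos).mono fun F hF => hF.1
  have hφ0 : ∀ᶠ F in folnerFilter G, 0 ≤ φ F :=
    hne.mono fun F hF => div_nonneg (hnonneg F hF) (Nat.cast_nonneg _)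
  suffices h : ∃ lam, Tendsto φ (folnerFilter G) (𝓝 lam) by
    obtain ⟨lam, hlam⟩ := h
    exact ⟨lam, ge_of_tendsto hlam hφ0, fun F hF => hlam.comp hF.tendsto_folnerFilter⟩
  cases finite_or_infinite G with
  | inl hfin =>
    have := Fintype.ofFinite G
    exact ⟨φ Finset.univ, tendsto_const_nhds.congr'
      (eventually_eq_univ_folnerFilter.mono fun F hF => by rw [hF])⟩
  | inr hinf =>
    have hφ1 : ∀ᶠ F in folnerFilter G, φ F ≤ f {1} := hne.mono fun F hF => by
      have hpos : (0 : ℝ) < F.card := by exact_mod_cast hF.card_pos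
      rw [div_le_iff₀' hpos]
      exact subadditive_le_card_mul hinv hsub hF
    have hbdd : IsBoundedUnder (· ≤ ·) (folnerFilter G) φ := ⟨_, eventually_map.2 hφ1⟩
    have hbdd' : IsBoundedUnder (· ≥ ·) (folnerFilter G) φ := ⟨_, eventually_map.2 hφ0⟩
    have hu : 0 ≤ limsup φ (folnerFilter G) :=
      le_limsup_of_frequently_le hφ0.frequently hbdd
    have hcomp : ∀ ε : ℝ, 0 < ε → ε ≤ 1 / 4 →
        limsup φ (folnerFilter G) * (1 - 2 * ε) ≤ liminf φ (folnerFilter G) + 5 * ε := by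
      intro ε hε hε'
      refine density_comparison hinv hsub hnonneg hu hε hε' (fun η hη => ?_) (fun η hη => ?_)
        (fun η hη => ?_)
      · exact eventually_lt_of_limsup_lt (lt_add_of_pos_right _ hη) hbdd
      · exact frequently_lt_of_lt_limsup hbdd'.isCoboundedUnder_flip (sub_lt_self _ hη)
      · exact frequently_lt_of_liminf_lt hbdd.isCoboundedUnder_flip (lt_add_of_pos_right _ hη)
    have hul : limsup φ (folnerFilter G) ≤ liminf φ (folnerFilter G) := by
      have h1 : Tendsto (fun ε : ℝ => limsup φ (folnerFilter G) * (1 - 2 * ε)) (𝓝[>] 0)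
          (𝓝 (limsup φ (folnerFilter G) * (1 - 2 * 0))) :=
        ((by fun_prop : Continuous fun ε : ℝ =>
          limsup φ (folnerFilter G) * (1 - 2 * ε)).tendsto 0).mono_left nhdsWithin_le_nhds
      have h2 : Tendsto (fun ε : ℝ => liminf φ (folnerFilter G) + 5 * ε) (𝓝[>] 0)
          (𝓝 (liminf φ (folnerFilter G) + 5 * 0)) :=
        ((by fun_prop : Continuous fun ε : ℝ =>
          liminf φ (folnerFilter G) + 5 * ε).tendsto 0).mono_left nhdsWithin_le_nhds
      have h3 := le_of_tendsto_of_tendsto h1 h2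
        (by filter_upwards [Ioc_mem_nhdsGT (show (0 : ℝ) < 1 / 4 by norm_num)] with ε hε
            exact hcomp ε hε.1 hε.2)
      simpa using h3
    exact ⟨_, tendsto_of_le_liminf_of_limsup_le le_rfl hul hbdd hbdd'⟩
end

section
/- Let G be a countable discrete amenable group and let f : 𝓕(G) → ℝ be monotone (f(E) ≤ f(F) whenever E ⊆ F), non-negative, G-invariant (f(Fg) = f(F)), and strongly sub-additive, i.e. f(E∪F) + f(E∩F) ≤ f(E) + f(F) for all E,F∈𝓕(G) (with the convention f(∅) = 0). Then for every Følner sequence (F_n) of G, lim_n f(F_n)/|F_n| = inf_{F∈𝓕(G)} f(F)/|F|. -/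
open MeasureTheory Filter Topology
open scoped Pointwise symmDiff Classical ENNReal

/-- Shearer's inequality for monotone submodular set functions: if every point of `F` lies in at
least `k` of the sets `K i`, then `k * f F ≤ ∑ i, f (K i ∩ F)`. -/
lemma nat_mul_le_sum_inter_of_submodular {α ι : Type*} [DecidableEq α] {f : Finset α → ℝ}
    (hmono : ∀ E F : Finset α, E ⊆ F → f E ≤ f F) (hempty : f ∅ = 0)
    (hstrong : ∀ E F : Finset α, f (E ∪ F) + f (E ∩ F) ≤ f E + f F)
    (I : Finset ι) (K : ι → Finset α) (k : ℕ) (F : Finset α)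
    (hcover : ∀ x ∈ F, k ≤ (I.filter fun i => x ∈ K i).card) :
    k * f F ≤ ∑ i ∈ I, f (K i ∩ F) := by
  induction F using Finset.induction_on with
  | empty => simp [hempty]
  | insert x F hx ih =>
    have ih' := ih fun y hy => hcover y (Finset.mem_insert_of_mem hy)
    have hd : 0 ≤ f (insert x F) - f F := sub_nonneg.2 (hmono _ _ (Finset.subset_insert x F))
    have hstep : ∀ i ∈ I, f (K i ∩ F) + (if x ∈ K i then f (insert x F) - f F else 0)
        ≤ f (K i ∩ insert x F) := by
      intro i _
      split_ifs with hi
      · have h := hstrong (K i ∩ insert x F) F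
        have hunion : K i ∩ insert x F ∪ F = insert x F := by grind
        have hinter : K i ∩ insert x F ∩ F = K i ∩ F := by grind
        rw [hunion, hinter] at h
        linarith
      · rw [add_zero]
        exact hmono _ _ (Finset.inter_subset_inter_left (Finset.subset_insert x F))
    have hsum := Finset.sum_le_sum hstep
    rw [Finset.sum_add_distrib, ← Finset.sum_filter, Finset.sum_const, nsmul_eq_mul] at hsum
    have hk : (k : ℝ) ≤ ((I.filter fun i => x ∈ K i).card : ℝ) := by
      exact_mod_cast hcover x (Finset.mem_insert_self x F)
    nlinarith [mul_le_mul_of_nonneg_right hk hd]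

/-- Covering `F` by the right translates of `E` that meet it. -/
lemma card_mul_le_card_biUnion_mul {G : Type*} [Group G] [DecidableEq G] {f : Finset G → ℝ}
    (hempty : f ∅ = 0) (hmono : ∀ E F : Finset G, E ⊆ F → f E ≤ f F)
    (hinv : ∀ (E : Finset G) (g : G), f (E.image fun a => a * g) = f E)
    (hstrong : ∀ E F : Finset G, f (E ∪ F) + f (E ∩ F) ≤ f E + f F) (E F : Finset G) :
    E.card * f F ≤ (E.biUnion fun e => e⁻¹ • F).card * f E := by
  set I := E.biUnion fun e => e⁻¹ • F with hI
  refine (nat_mul_le_sum_inter_of_submodular hmono hempty hstrong I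
    (fun g => E.image fun a => a * g) E.card F fun x hx => ?_).trans ?_
  · refine Finset.card_le_card_of_injOn (fun e => e⁻¹ * x) (fun e he => ?_) ?_
    · simp only [Finset.coe_filter, Set.mem_ofPred_eq, hI, Finset.mem_biUnion, Finset.mem_image]
      exact ⟨⟨e, he, Finset.smul_mem_smul_finset hx⟩, e, he, by simp⟩
    · intro a _ b _ hab
      simpa using hab
  · calc ∑ g ∈ I, f ((E.image fun a => a * g) ∩ F)
        ≤ ∑ _g ∈ I, f E := Finset.sum_le_sum fun g _ =>
          (hmono _ _ Finset.inter_subset_left).trans (hinv E g).le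
      _ = I.card * f E := by rw [Finset.sum_const, nsmul_eq_mul]

/-- The union of the translates `e⁻¹ • F` exceeds `F` by at most the total translation error. -/
lemma card_biUnion_inv_smul_le {G : Type*} [Group G] [DecidableEq G] (E F : Finset G) :
    (E.biUnion fun e => e⁻¹ • F).card ≤ F.card + ∑ e ∈ E, ((e⁻¹ • F) ∆ F).card := by
  have hsub : (E.biUnion fun e => e⁻¹ • F) ⊆ F ∪ E.biUnion fun e => (e⁻¹ • F) ∆ F := by
    intro x hx
    obtain ⟨e, he, hxe⟩ := Finset.mem_biUnion.1 hx
    by_cases hxF : x ∈ F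
    · exact Finset.mem_union_left _ hxF
    · exact Finset.mem_union_right _
        (Finset.mem_biUnion.2 ⟨e, he, Finset.mem_symmDiff.2 (Or.inl ⟨hxe, hxF⟩)⟩)
  exact (Finset.card_le_card hsub).trans
    ((Finset.card_union_le _ _).trans (Nat.add_le_add_left Finset.card_biUnion_le _))

/-- **Ornstein–Weiss limit for strongly sub-additive functions** (Remark 2.2(1)).
Let `G` be a countable amenable group and `f : 𝓕(G) → ℝ` a monotone, non-negative,
`G`-invariant, strongly sub-additive function (with the convention `f(∅) = 0`). Then for every
Følner sequence `(F_n)` of `G`, `lim_n f(F_n)/|F_n| = inf_{F ∈ 𝓕(G)} f(F)/|F|`. -/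
theorem ornstein_weiss_strongly_subadditive {G : Type*} [Group G] [Countable G] [DecidableEq G]
    (hamen : ∃ F : ℕ → Finset G, FolnerSeq G F)
    (f : Finset G → ℝ)
    (hempty : f ∅ = 0)
    (hmono : ∀ E F : Finset G, E ⊆ F → f E ≤ f F)
    (hnonneg : ∀ E : Finset G, 0 ≤ f E)
    (hinv : ∀ (E : Finset G) (g : G), f (E.image fun a => a * g) = f E)
    (hstrong : ∀ E F : Finset G, f (E ∪ F) + f (E ∩ F) ≤ f E + f F) :
    ∀ F : ℕ → Finset G, FolnerSeq G F →
      Tendsto (fun n => f (F n) / (F n).card) atTop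
        (𝓝 (sInf {r : ℝ | ∃ E : Finset G, E.Nonempty ∧ r = f E / E.card})) := by
  intro F hF
  set S := {r : ℝ | ∃ E : Finset G, E.Nonempty ∧ r = f E / E.card}
  have hbdd : BddBelow S := by
    refine ⟨0, ?_⟩
    rintro _ ⟨E, _, rfl⟩
    exact div_nonneg (hnonneg E) (Nat.cast_nonneg _)
  have hne : S.Nonempty := ⟨_, F 0, hF.1 0, rfl⟩
  have hlower : ∀ n, sInf S ≤ f (F n) / (F n).card := fun n => csInf_le hbdd ⟨F n, hF.1 n, rfl⟩
  refine tendsto_order.2 ⟨fun a ha => Eventually.of_forall fun n => ha.trans_le (hlower n),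
    fun c hc => ?_⟩
  obtain ⟨_, ⟨E, hE, rfl⟩, hEc⟩ := exists_lt_of_csInf_lt hne hc
  have hlim : Tendsto (fun n => f E / E.card *
      (1 + ∑ e ∈ E, (((e⁻¹ • F n) ∆ F n).card : ℝ) / (F n).card)) atTop (𝓝 (f E / E.card)) := by
    have h := tendsto_finsetSum E fun e _ => hF.2 e⁻¹
    simpa using (h.const_add 1).const_mul (f E / E.card)
  filter_upwards [hlim.eventually (gt_mem_nhds hEc)] with n hn
  refine lt_of_le_of_lt ?_ hn
  have hEpos : (0 : ℝ) < E.card := by exact_mod_cast hE.card_pos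
  have hFpos : (0 : ℝ) < (F n).card := by exact_mod_cast (hF.1 n).card_pos
  have hcov := card_mul_le_card_biUnion_mul hempty hmono hinv hstrong E (F n)
  have hcard : ((E.biUnion fun e => e⁻¹ • F n).card : ℝ)
      ≤ (F n).card + ∑ e ∈ E, (((e⁻¹ • F n) ∆ F n).card : ℝ) := by
    exact_mod_cast card_biUnion_inv_smul_le E (F n)
  have hbound := hcov.trans (mul_le_mul_of_nonneg_right hcard (hnonneg E))
  rw [← Finset.sum_div, one_add_div hFpos.ne', div_mul_div_comm,
    div_le_div_iff₀ hFpos (mul_pos hEpos hFpos)]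
  nlinarith [mul_le_mul_of_nonneg_right hbound hFpos.le]
end

section
/- Let G be a countable discrete amenable group, T ∈ 𝓕(G) a tile of G with set of tiling centers C (so {Tc : c∈C} is a pairwise disjoint family whose union is G), and (F_n) a Følner sequence of G. For each n, let C_n := {c ∈ C : Tc ∩ F_n ≠ ∅} (so F_n ⊆ ⊔_{c∈C_n} Tc and Tc ∩ F_n ≠ ∅ for all c∈C_n). Then |T C_n| / |F_n| → 1 as n → ∞. -/
open MeasureTheory Filter Topology
open scoped Pointwise symmDiff Classical ENNReal

/-- The translates `Tc` meeting a set `A` stay within `A` up to the boundary terms `gA ∆ A`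
with `g ∈ T T⁻¹`. -/
theorem iUnion_translates_subset {G : Type*} [Group G] [DecidableEq G]
    (T : Finset G) (Ctr : Set G) (A : Finset G) :
    (⋃ c ∈ {c ∈ Ctr | ∃ t ∈ T, t * c ∈ A}, (fun t => t * c) '' (↑T : Set G)) ⊆
      ↑(A ∪ (T ×ˢ T).biUnion fun p => ((p.1 * p.2⁻¹) • A) ∆ A) := by
  intro x hx
  simp only [Set.mem_iUnion, Set.mem_image, Finset.mem_coe] at hx
  obtain ⟨c, ⟨-, t, ht, htc⟩, s, hs, rfl⟩ := hx
  by_cases h : s * c ∈ A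
  · exact Finset.mem_coe.2 (Finset.mem_union_left _ h)
  · refine Finset.mem_coe.2 (Finset.mem_union_right _ (Finset.mem_biUnion.2
      ⟨(s, t), Finset.mk_mem_product hs ht, Finset.mem_symmDiff.2 (Or.inl ⟨?_, h⟩)⟩))
    exact Finset.mem_smul_finset.2 ⟨t * c, htc, by simp [mul_assoc]⟩

/-- If the translates `Tc` cover the group, those meeting `A` cover `A`. -/
theorem subset_iUnion_translates {G : Type*} [Group G]
    (T : Finset G) (Ctr : Set G)
    (hcover : ⋃ c ∈ Ctr, (fun t => t * c) '' (↑T : Set G) = Set.univ) (A : Finset G) :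
    (↑A : Set G) ⊆
      ⋃ c ∈ {c ∈ Ctr | ∃ t ∈ T, t * c ∈ A}, (fun t => t * c) '' (↑T : Set G) := by
  intro x hx
  have h : x ∈ ⋃ c ∈ Ctr, (fun t => t * c) '' (↑T : Set G) := hcover ▸ Set.mem_univ x
  simp only [Set.mem_iUnion, Set.mem_image, Finset.mem_coe] at h ⊢
  obtain ⟨c, hc, t, ht, rfl⟩ := h
  exact ⟨c, ⟨hc, t, ht, hx⟩, t, ht, rfl⟩

/-- **Tiling covers of Følner sets are asymptotically tight** (Lemma 3.1).
Let `T` be a tile of `G` with tiling centers `Ctr` (so `{Tc : c ∈ Ctr}` is a pairwise disjoint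
family whose union is `G`), and let `(F_n)` be a Følner sequence. With
`C_n = {c ∈ Ctr : Tc ∩ F_n ≠ ∅}`, one has `|T C_n| / |F_n| → 1`. -/
theorem tiling_center_cover_ratio {G : Type*} [Group G] [Countable G] [DecidableEq G]
    (T : Finset G) (hT : T.Nonempty) (Ctr : Set G)
    (hdisj : Ctr.PairwiseDisjoint fun c => (fun t => t * c) '' (↑T : Set G))
    (hcover : ⋃ c ∈ Ctr, (fun t => t * c) '' (↑T : Set G) = Set.univ)
    (F : ℕ → Finset G) (hF : FolnerSeq G F) :
    Tendsto (fun n =>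
      ((⋃ c ∈ {c ∈ Ctr | ∃ t ∈ T, t * c ∈ F n}, (fun t => t * c) '' (↑T : Set G)).ncard : ℝ) /
        (F n).card) atTop (𝓝 1) := by
  obtain ⟨hne, hlim⟩ := hF
  have hsum : Tendsto (fun n => 1 + ∑ p ∈ T ×ˢ T,
      ((((p.1 * p.2⁻¹) • F n) ∆ F n).card : ℝ) / (F n).card) atTop (𝓝 1) := by
    simpa using (tendsto_finsetSum (T ×ˢ T) fun p _ => hlim (p.1 * p.2⁻¹)).const_add 1
  refine tendsto_of_tendsto_of_tendsto_of_le_of_le tendsto_const_nhds hsum ?_ ?_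
  · intro n
    have hpos : (0 : ℝ) < (F n).card := by exact_mod_cast (hne n).card_pos
    have hfin := (Finset.finite_toSet _).subset (iUnion_translates_subset T Ctr (F n))
    have h := Set.ncard_le_ncard (subset_iUnion_translates T Ctr hcover (F n)) hfin
    rw [Set.ncard_coe_finset] at h
    exact (one_le_div hpos).2 (by exact_mod_cast h)
  · intro n
    have hpos : (0 : ℝ) < (F n).card := by exact_mod_cast (hne n).card_pos
    have h := Set.ncard_le_ncard (iUnion_translates_subset T Ctr (F n)) (Finset.finite_toSet _)
    rw [Set.ncard_coe_finset] at h
    have h' := h.trans ((Finset.card_union_le _ _).trans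
      (Nat.add_le_add_left Finset.card_biUnion_le _))
    dsimp only
    rw [← Finset.sum_div, ← div_self hpos.ne', ← add_div]
    gcongr
    exact_mod_cast h'
end

section
/- Let G be a countable discrete group and f : 𝓕(G) → ℝ a non-negative, monotone (f(E) ≤ f(F) for E ⊆ F), strongly sub-additive function (f(E∪F) + f(E∩F) ≤ f(E) + f(F) for all E,F, with the convention f(∅)=0). Let m, k ∈ ℕ and E, E_1, …, E_k ∈ 𝓕(G). If 1_E(g) = (1/m) Σ_{i=1}^k 1_{E_i}(g) for every g ∈ G (i.e., every element of E lies in exactly m of the sets E_i and every element outside E lies in none of them), then f(E) ≤ (1/m) Σ_{i=1}^k f(E_i). -/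
open MeasureTheory Filter Topology
open scoped Pointwise symmDiff Classical ENNReal

/-- If every element of `S` lies in exactly `m` of the sets `A i`, then a strongly sub-additive
`f` with `f ∅ = 0` satisfies `m * f S ≤ ∑ i, f (S ∩ A i)`. -/
theorem mul_le_sum_inter_of_strongly_subadditive {α ι : Type*} [DecidableEq α] [Fintype ι]
    (f : Finset α → ℝ) (hempty : f ∅ = 0)
    (hstrong : ∀ E F : Finset α, f (E ∪ F) + f (E ∩ F) ≤ f E + f F)
    (m : ℝ) (A : ι → Finset α) (S : Finset α)
    (hcount : ∀ a ∈ S, m = ∑ i, if a ∈ A i then (1 : ℝ) else 0) :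
    m * f S ≤ ∑ i, f (S ∩ A i) := by
  induction S using Finset.induction_on with
  | empty => simp [hempty]
  | insert a S ha ih =>
    have hS := ih fun b hb => hcount b (Finset.mem_insert_of_mem hb)
    have hmarginal : ∀ i, (if a ∈ A i then (1 : ℝ) else 0) * (f (insert a S) - f S) ≤
        f (insert a S ∩ A i) - f (S ∩ A i) := by
      intro i
      split_ifs with hi
      · have h := hstrong (insert a S ∩ A i) S
        have hunion : insert a S ∩ A i ∪ S = insert a S := by grind
        have hinter : insert a S ∩ A i ∩ S = S ∩ A i := by grind
        rw [hunion, hinter] at h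
        linarith
      · rw [Finset.insert_inter_of_notMem hi]
        simp
    have hsum := Finset.sum_le_sum fun i (_ : i ∈ Finset.univ) => hmarginal i
    rw [← Finset.sum_mul, ← hcount a (Finset.mem_insert_self a S), Finset.sum_sub_distrib] at hsum
    linarith

/-- **Averaging inequality for strongly sub-additive functions** (Lemma 3.2(1)).
Let `f : 𝓕(G) → ℝ` be non-negative, monotone and strongly sub-additive (with `f(∅) = 0`).
If `1_E(g) = (1/m) Σ_{i=1}^k 1_{E_i}(g)` for every `g ∈ G` (each element of `E` lies in exactly
`m` of the `E_i`, and no element outside `E` lies in any of them), then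
`f(E) ≤ (1/m) Σ_{i=1}^k f(E_i)`. -/
theorem strongly_subadditive_average {G : Type*} [Group G] [Countable G] [DecidableEq G]
    (f : Finset G → ℝ)
    (hempty : f ∅ = 0)
    (hnonneg : ∀ E : Finset G, 0 ≤ f E)
    (hmono : ∀ E F : Finset G, E ⊆ F → f E ≤ f F)
    (hstrong : ∀ E F : Finset G, f (E ∪ F) + f (E ∩ F) ≤ f E + f F)
    (m k : ℕ) (hm : 0 < m)
    (E : Finset G) (hE : E.Nonempty)
    (Ei : Fin k → Finset G) (hEi : ∀ i, (Ei i).Nonempty)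
    (hcount : ∀ g : G, (m : ℝ) * (if g ∈ E then (1 : ℝ) else 0) =
      ∑ i, if g ∈ Ei i then (1 : ℝ) else 0) :
    f E ≤ (1 / m : ℝ) * ∑ i, f (Ei i) := by
  have hsub : ∀ i, E ∩ Ei i = Ei i := by
    intro i
    refine Finset.inter_eq_right.mpr fun g hg => ?_
    by_contra hgE
    have h := hcount g
    rw [if_neg hgE, mul_zero, eq_comm,
      Finset.sum_eq_zero_iff_of_nonneg fun _ _ => by split_ifs <;> norm_num] at h
    simpa [hg] using h i (Finset.mem_univ i)
  have hle := mul_le_sum_inter_of_strongly_subadditive f hempty hstrong m Ei E fun g hg => by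
    simpa only [if_pos hg, mul_one] using hcount g
  simp only [hsub] at hle
  rw [one_div_mul_eq_div, le_div_iff₀ (Nat.cast_pos.mpr hm), mul_comm]
  exact hle
end

section
/- Let G be a countable discrete group and f : 𝓕(G) → ℝ a non-negative, monotone (f(E) ≤ f(F) for E ⊆ F), strongly sub-additive function (f(E∪F) + f(E∩F) ≤ f(E) + f(F) for all E,F, with the convention f(∅)=0). Assume K := sup{ f(E)/|E| : E ∈ 𝓕(G) } < ∞. Then for all F, B ∈ 𝓕(G), f(F) ≤ Σ_{g∈F} (1/|B|) f(Bg) + K·|F \ A_{F,B}|, where A_{F,B} := { g ∈ G : B⁻¹g ⊆ F }. -/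
open MeasureTheory Filter Topology
open scoped Pointwise symmDiff Classical ENNReal

/-- If the sets `E i`, `i ∈ s`, cover every point of `F` at least `k` times, then a monotone
strongly sub-additive function `f` satisfies `k * f F ≤ ∑ i ∈ s, f (E i ∩ F)`. -/
theorem mul_le_sum_inter_of_cover {α ι : Type*} [DecidableEq α] (f : Finset α → ℝ)
    (hempty : f ∅ = 0) (hmono : ∀ E F : Finset α, E ⊆ F → f E ≤ f F)
    (hstrong : ∀ E F : Finset α, f (E ∪ F) + f (E ∩ F) ≤ f E + f F)
    (s : Finset ι) (E : ι → Finset α) (k : ℕ) (F : Finset α)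
    (hcover : ∀ x ∈ F, k ≤ (s.filter fun i => x ∈ E i).card) :
    k * f F ≤ ∑ i ∈ s, f (E i ∩ F) := by
  induction F using Finset.induction_on with
  | empty => simp [hempty]
  | insert x F hx ih =>
    have ih' := ih fun y hy => hcover y (Finset.mem_insert_of_mem hy)
    have hcard : (k : ℝ) ≤ (s.filter fun i => x ∈ E i).card :=
      mod_cast hcover x (Finset.mem_insert_self x F)
    have hincr : 0 ≤ f (insert x F) - f F := sub_nonneg.2 (hmono _ _ (Finset.subset_insert x F))
    have hterm : ∀ i ∈ s, f (E i ∩ F) + (if x ∈ E i then f (insert x F) - f F else 0) ≤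
        f (E i ∩ insert x F) := by
      intro i _
      split_ifs with hi
      · have h := hstrong (E i ∩ insert x F) F
        have hunion : E i ∩ insert x F ∪ F = insert x F := by grind
        have hinter : E i ∩ insert x F ∩ F = E i ∩ F := by grind
        rw [hunion, hinter] at h
        linarith
      · rw [Finset.inter_insert_of_notMem hi, add_zero]
    have hsum := Finset.sum_le_sum hterm
    rw [Finset.sum_add_distrib, ← Finset.sum_filter, Finset.sum_const, nsmul_eq_mul] at hsum
    have hmul := mul_le_mul_of_nonneg_right hcard hincr
    linarith

/-- **Covering estimate for strongly sub-additive functions** (Lemma 3.2(2)).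
Let `f : 𝓕(G) → ℝ` be non-negative, monotone and strongly sub-additive (with `f(∅) = 0`), and
suppose `K = sup { f(E)/|E| : E ∈ 𝓕(G) } < ∞`. Then for all `F, B ∈ 𝓕(G)`,
`f(F) ≤ Σ_{g∈F} (1/|B|) f(Bg) + K · |F \ A_{F,B}|`, where `A_{F,B} = {g ∈ G : B⁻¹g ⊆ F}`. -/
theorem strongly_subadditive_covering_estimate {G : Type*} [Group G] [Countable G] [DecidableEq G]
    (f : Finset G → ℝ)
    (hempty : f ∅ = 0)
    (hnonneg : ∀ E : Finset G, 0 ≤ f E)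
    (hmono : ∀ E F : Finset G, E ⊆ F → f E ≤ f F)
    (hstrong : ∀ E F : Finset G, f (E ∪ F) + f (E ∩ F) ≤ f E + f F)
    (K : ℝ) (hK : ∀ E : Finset G, E.Nonempty → f E / E.card ≤ K)
    (F B : Finset G) (hF : F.Nonempty) (hB : B.Nonempty) :
    f F ≤ (∑ g ∈ F, f (B.image fun b => b * g) / B.card) +
      K * (F.filter fun g => ¬ ∀ b ∈ B, b⁻¹ * g ∈ F).card := by
  have hBpos : (0 : ℝ) < B.card := mod_cast hB.card_pos
  set P := F.filter fun g => ∀ b ∈ B, b⁻¹ * g ∈ F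
  set Q := F.filter fun g => ¬ ∀ b ∈ B, b⁻¹ * g ∈ F
  have hPQ : P ∪ Q = F := Finset.filter_union_filter_not_eq _ F
  have hsub : f F ≤ f P + f Q := by
    have h := hstrong P Q
    rw [hPQ] at h
    linarith [hnonneg (P ∩ Q)]
  have hfQ : f Q ≤ K * Q.card := by
    rcases Q.eq_empty_or_nonempty with h | h
    · simp [h, hempty]
    · exact (div_le_iff₀ (mod_cast h.card_pos)).1 (hK Q h)
  have hcover : ∀ x ∈ P, B.card ≤ (F.filter fun g => x ∈ B.image fun b => b * g).card := by
    intro x hx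
    refine Finset.card_le_card_of_injOn (fun b => b⁻¹ * x) ?_ ?_
    · intro b hb
      have hxb := (Finset.mem_filter.1 hx).2 b hb
      exact Finset.mem_coe.2 (Finset.mem_filter.2
        ⟨hxb, Finset.mem_image.2 ⟨b, hb, mul_inv_cancel_left b x⟩⟩)
    · intro b _ c _ h
      exact inv_injective (mul_right_cancel h)
  have hfP : f P ≤ ∑ g ∈ F, f (B.image fun b => b * g) / B.card := by
    rw [← Finset.sum_div, le_div_iff₀ hBpos, mul_comm]
    refine (mul_le_sum_inter_of_cover f hempty hmono hstrong F
      (fun g => B.image fun b => b * g) B.card P fun x hx => ?_).trans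
      (Finset.sum_le_sum fun g _ => hmono _ _ Finset.inter_subset_left)
    exact hcover x hx
  linarith
end

section
/- Let (X,G) be a zero-dimensional G-system, 𝓕 = {f_E}_{E∈𝓕(G)} a sub-additive potential on (X,G), and 𝓤 a finite open cover of X. Let K ∈ ℕ and let α_1, …, α_K be finite clopen partitions of X, each finer than 𝓤. Then for each E ∈ 𝓕(G) there is a finite subset B_E of X such that every atom of (α_l)_E := ⋁_{g∈E} g⁻¹α_l contains at most one point of B_E for each l = 1, …, K, and Σ_{x∈B_E} e^{f_E(x)} ≥ P_E(G,𝓕;𝓤)/K. -/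
open MeasureTheory Filter Topology
open scoped Pointwise symmDiff Classical ENNReal

/-- Greedy selection: given finitely many locally constant labellings of a compact space, there is
a finite set on which each labelling is injective and such that each point shares some label with
a point of the set at which `φ` is at least as large. -/
theorem exists_finset_injOn_dominating {X L C : Type*} [TopologicalSpace X] [CompactSpace X]
    [Finite L] [Nonempty L] {φ : X → ℝ} (hφ : Continuous φ) {c : L → X → C}
    (hc : ∀ l, IsLocallyConstant (c l)) :
    ∃ B : Finset X, (∀ l, Set.InjOn (c l) B) ∧
      ∀ x, ∃ b ∈ B, ∃ l, c l x = c l b ∧ φ x ≤ φ b := by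
  obtain ⟨l₀⟩ := ‹Nonempty L›
  suffices h : ∀ (n : ℕ) (Y : Set X), IsClosed Y → (c l₀ '' Y).ncard = n →
      ∃ B : Finset X, (↑B : Set X) ⊆ Y ∧ (∀ l, Set.InjOn (c l) B) ∧
        ∀ x ∈ Y, ∃ b ∈ B, ∃ l, c l x = c l b ∧ φ x ≤ φ b by
    obtain ⟨B, -, hinj, hdom⟩ := h _ Set.univ isClosed_univ rfl
    exact ⟨B, hinj, fun x => hdom x (Set.mem_univ x)⟩
  intro n
  induction n using Nat.strong_induction_on with
  | _ n ih =>
    intro Y hY hn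
    rcases Y.eq_empty_or_nonempty with rfl | hne
    · exact ⟨∅, by simp, by simp, by simp⟩
    obtain ⟨b, hbY, hb⟩ := hY.isCompact.exists_isMaxOn hne hφ.continuousOn
    set Z : Set X := Y ∩ ⋂ l, {x | c l x ≠ c l b} with hZ
    have hZclosed : IsClosed Z :=
      hY.inter (isClosed_iInter fun l => ((hc l).isOpen_fiber (c l b)).isClosed_compl)
    have hfin : (c l₀ '' Y).Finite := (hc l₀).range_finite.subset (Set.image_subset_range _ _)
    have hlt : (c l₀ '' Z).ncard < n := by
      rw [← hn]
      refine Set.ncard_lt_ncard ⟨Set.image_mono Set.inter_subset_left, fun hsub => ?_⟩ hfin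
      obtain ⟨x, hx, hxb⟩ := hsub ⟨b, hbY, rfl⟩
      exact Set.mem_iInter.1 hx.2 l₀ hxb
    obtain ⟨B, hBZ, hinj, hdom⟩ := ih _ hlt Z hZclosed rfl
    refine ⟨insert b B, ?_, fun l => ?_, fun x hx => ?_⟩
    · rw [Finset.coe_insert]
      exact Set.insert_subset hbY (hBZ.trans Set.inter_subset_left)
    · have hbB : b ∉ (↑B : Set X) := fun h => Set.mem_iInter.1 (hBZ h).2 l rfl
      rw [Finset.coe_insert, Set.injOn_insert hbB]
      refine ⟨hinj l, ?_⟩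
      rintro ⟨x, hx, hxb⟩
      exact Set.mem_iInter.1 (hBZ hx).2 l hxb
    · by_cases hxZ : x ∈ Z
      · obtain ⟨b', hb', h⟩ := hdom x hxZ
        exact ⟨b', Finset.mem_insert_of_mem hb', h⟩
      · have : ∃ l, c l x = c l b := by
          by_contra! h
          exact hxZ ⟨hx, Set.mem_iInter.2 h⟩
        obtain ⟨l, hl⟩ := this
        exact ⟨b, Finset.mem_insert_self _ _, l, hl, hb hx⟩

/-- The `(P)_E`-name of a point: which members of `P` contain its translates by elements of `E`. -/
def dynName {G X : Type*} [SMul G X] (P : Finset (Set X)) (E : Finset G) (x : X) :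
    Set (G × Set X) :=
  {p | p ∈ E ×ˢ P ∧ p.1 • x ∈ p.2}

theorem isLocallyConstant_dynName {G X : Type*} [SMul G X] [TopologicalSpace X]
    (hact : ∀ g : G, Continuous fun x : X => g • x) {P : Finset (Set X)}
    (hP : ∀ A ∈ P, IsClopen A) (E : Finset G) : IsLocallyConstant (dynName P E : X → _) := by
  rw [IsLocallyConstant.iff_eventually_eq]
  intro x
  have h : ∀ᶠ y in 𝓝 x, ∀ p ∈ E ×ˢ P, (p.1 • y ∈ p.2 ↔ p.1 • x ∈ p.2) := by
    rw [Filter.eventually_all_finset]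
    intro p hp
    have hcl : IsClopen ((fun x : X => p.1 • x) ⁻¹' p.2) :=
      (hP _ (Finset.mem_product.1 hp).2).preimage (hact p.1)
    by_cases hx : p.1 • x ∈ p.2
    · filter_upwards [hcl.isOpen.mem_nhds hx] with y hy
      exact iff_of_true hy hx
    · filter_upwards [hcl.compl.isOpen.mem_nhds hx] with y hy
      exact iff_of_false hy hx
  filter_upwards [h] with y hy
  ext p
  exact and_congr_right fun hp => hy p hp

/-- Two points in a common member of `DynRefine G P E` have the same name, for `P` disjoint. -/
theorem dynName_eq_of_mem {G X : Type*} [SMul G X] {P : Finset (Set X)}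
    (hP : (↑P : Set (Set X)).PairwiseDisjoint id) {E : Finset G} {V : Set X}
    (hV : V ∈ DynRefine G P E) {x y : X} (hx : x ∈ V) (hy : y ∈ V) :
    dynName P E x = dynName P E y := by
  obtain ⟨u, hu, rfl⟩ := hV
  have key : ∀ a ∈ ⋂ g ∈ E, (fun x : X => g • x) ⁻¹' u g, ∀ p ∈ E ×ˢ P,
      (p.1 • a ∈ p.2 ↔ p.2 = u p.1) := by
    intro a ha p hp
    obtain ⟨hpE, hpP⟩ := Finset.mem_product.1 hp
    have hau : p.1 • a ∈ u p.1 := Set.mem_iInter₂.1 ha p.1 hpE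
    refine ⟨fun h => hP.elim_set hpP (hu _ hpE) _ h hau, fun h => h ▸ hau⟩
  ext p
  exact and_congr_right fun hp => (key x hx p hp).trans (key y hy p hp).symm

/-- A `P`-name class lies in a member of `DynRefine G U E` when the cover `P` is finer than `U`. -/
theorem exists_dynRefine_superset {G X : Type*} [SMul G X] {P U : Finset (Set X)}
    (hcover : ⋃₀ (↑P : Set (Set X)) = Set.univ) (hPU : IsFinerFam (↑P : Set (Set X)) ↑U)
    (E : Finset G) (b : X) :
    ∃ W ∈ DynRefine G U E, {x | dynName P E x = dynName P E b} ⊆ W := by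
  have hA : ∀ g : G, ∃ A ∈ P, g • b ∈ A := fun g =>
    Set.mem_sUnion.1 (hcover.symm ▸ Set.mem_univ (g • b))
  choose A hAP hbA using hA
  choose u hu hAu using fun g => hPU (A g) (hAP g)
  refine ⟨_, ⟨u, fun g _ => hu g, rfl⟩, fun x hx => Set.mem_iInter₂.2 fun g hg => hAu g ?_⟩
  have hmem : (g, A g) ∈ dynName P E b := ⟨Finset.mem_product.2 ⟨hg, hAP g⟩, hbA g⟩
  rw [← show dynName P E x = dynName P E b from hx] at hmem
  exact hmem.2

/-- **Choice of separated sets carrying the pressure** (Lemma 3.3).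
Let `(X,G)` be a zero-dimensional `G`-system, `𝓕` a sub-additive potential, `𝓤` a finite open
cover, and `α_1, …, α_K` finite clopen partitions of `X` finer than `𝓤`. Then for each
`E ∈ 𝓕(G)` there is a finite set `B_E ⊆ X` such that every atom of `(α_l)_E` contains at most
one point of `B_E` (for every `l`), and `Σ_{x∈B_E} e^{f_E(x)} ≥ P_E(G,𝓕;𝓤)/K`. -/
theorem separated_set_for_pressure
    {G X : Type*} [Group G] [Countable G] [DecidableEq G]
    [MetricSpace X] [CompactSpace X] [MeasurableSpace X] [BorelSpace X]
    [MulAction G X] (hact : ∀ g : G, Continuous fun x : X => g • x)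
    (hzd : ∀ (x : X) (U : Set X), IsOpen U → x ∈ U → ∃ V : Set X, IsClopen V ∧ x ∈ V ∧ V ⊆ U)
    (f : Finset G → X → ℝ) (hf : SubaddPotential G f)
    (U : Finset (Set X)) (hUopen : ∀ A ∈ U, IsOpen A)
    (hUcover : ⋃₀ (↑U : Set (Set X)) = Set.univ)
    (K : ℕ) (hK : 0 < K) (α : Fin K → Finset (Set X))
    (hclopen : ∀ l, ∀ A ∈ α l, IsClopen A)
    (hpart : ∀ l, IsBorelPartition (α l))
    (hfiner : ∀ l, IsFinerFam (↑(α l)) (↑U : Set (Set X)))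
    (E : Finset G) (hE : E.Nonempty) :
    ∃ B : Finset X,
      (∀ l, ∀ V ∈ DynRefine G (α l) E, ∀ x ∈ B, ∀ y ∈ B, x ∈ V → y ∈ V → x = y) ∧
      CoverPressure G f U E / K ≤ ∑ x ∈ B, Real.exp (f E x) := by
  have hφ := hf.1 E
  have : Nonempty (Fin K) := ⟨⟨0, hK⟩⟩
  have hc : ∀ l, IsLocallyConstant (dynName (α l) E : X → Set (G × Set X)) :=
    fun l => isLocallyConstant_dynName hact (hclopen l) E
  obtain ⟨B, hinj, hdom⟩ := exists_finset_injOn_dominating hφ hc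
  refine ⟨B, fun l V hV x hx y hy hxV hyV =>
    hinj l hx hy (dynName_eq_of_mem (hpart l).2.2 hV hxV hyV), ?_⟩
  let W : X × Fin K → Set X :=
    fun p => {x | dynName (α p.2) E x = dynName (α p.2) E p.1} ∩ {x | f E x ≤ f E p.1}
  let 𝓥 : Finset (Set X) := (B ×ˢ Finset.univ).image W
  have hnonneg : ∀ A : Set X, 0 ≤ ⨆ x ∈ A, Real.exp (f E x) := fun A =>
    Real.iSup_nonneg fun x => Real.iSup_nonneg fun _ => (Real.exp_pos _).le
  have hle : CoverPressure G f U E ≤ ∑ A ∈ 𝓥, ⨆ x ∈ A, Real.exp (f E x) := by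
    refine csInf_le ⟨0, ?_⟩ ⟨𝓥, ?_, ?_, ?_, rfl⟩
    · rintro S ⟨V, -, -, -, rfl⟩
      exact Finset.sum_nonneg fun A _ => hnonneg A
    · intro A hA
      obtain ⟨p, -, rfl⟩ := Finset.mem_image.1 hA
      exact ((hc p.2).isOpen_fiber _).measurableSet.inter
        (isClosed_le hφ continuous_const).measurableSet
    · refine Set.eq_univ_of_forall fun x => ?_
      obtain ⟨b, hb, l, hl, hxb⟩ := hdom x
      exact ⟨W (b, l), Finset.mem_coe.2 (Finset.mem_image_of_mem W (by simp [hb])), hl, hxb⟩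
    · intro A hA
      obtain ⟨p, -, rfl⟩ := Finset.mem_image.1 (Finset.mem_coe.1 hA)
      obtain ⟨V, hV, hsub⟩ :=
        exists_dynRefine_superset (hpart p.2).2.1 (hfiner p.2) E p.1
      exact ⟨V, hV, Set.inter_subset_left.trans hsub⟩
  have hsum : ∑ A ∈ 𝓥, ⨆ x ∈ A, Real.exp (f E x) ≤ K * ∑ x ∈ B, Real.exp (f E x) := by
    calc ∑ A ∈ 𝓥, ⨆ x ∈ A, Real.exp (f E x)
        ≤ ∑ p ∈ B ×ˢ Finset.univ, ⨆ x ∈ W p, Real.exp (f E x) :=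
          Finset.sum_image_le_of_nonneg fun A _ => hnonneg A
      _ ≤ ∑ p ∈ B ×ˢ (Finset.univ : Finset (Fin K)), Real.exp (f E p.1) :=
          Finset.sum_le_sum fun p _ => Real.iSup_le (fun x => Real.iSup_le
            (fun hx => Real.exp_le_exp.2 hx.2) (Real.exp_pos _).le) (Real.exp_pos _).le
      _ = K * ∑ x ∈ B, Real.exp (f E x) := by
          simp [Finset.sum_product, Finset.mul_sum]
  rw [div_le_iff₀' (by exact_mod_cast hK)]
  exact hle.trans hsum
end
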